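/- Let H be a cocommutative weak Hopf algebra over a commutative ring k. Two H-cleft extensions A_H ↪ A and A_H ↪ B with the same coinvariant algebra A_H, each admitting a convolution invertible total integral, are equivalent if and only if their associated crossed systems (induced on A_H by convolution invertible total integrals) are equivalent. -/

import Mathlib

open TensorProduct

noncomputable section

namespace WHA

variable (k : Type) [CommRing k]

/-- Generalized convolution product of two linear maps from a "coalgebra"
(given by a comultiplication `δC`) to a module `P` with a product `m`. -/
def convG {C P : Type} [AddCommGroup C] [Module k C] [AddCommGroup P] [Module k P]
    (δC : C →ₗ[k] C ⊗[k] C) (m : P ⊗[k] P →ₗ[k] P) (f g : C →ₗ[k] P) : C →ₗ[k] P :=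
  m ∘ₗ TensorProduct.map f g ∘ₗ δC

/-- Convolution product of two linear maps from a "coalgebra" to an algebra. -/
def conv {C A : Type} [AddCommGroup C] [Module k C] [Ring A] [Algebra k A]
    (δC : C →ₗ[k] C ⊗[k] C) (f g : C →ₗ[k] A) : C →ₗ[k] A :=
  convG k δC (LinearMap.mul' k A) f g

variable (H : Type) [Ring H] [Algebra k H]

/-- The structure maps (comultiplication, counit, antipode) of a prospective
weak Hopf algebra on the `k`-algebra `H`. -/
structure HopfData where
  δ : H →ₗ[k] H ⊗[k] H
  ε : H →ₗ[k] k
  lam : H →ₗ[k] H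

variable {k H}

/-- The target map `Π^L_H = ((ε∘μ)⊗H)∘(H⊗c)∘((δ∘η)⊗H)`. -/
def PiL (W : HopfData k H) : H →ₗ[k] H :=
  (TensorProduct.rid k H).toLinearMap
    ∘ₗ LinearMap.lTensor H (W.ε ∘ₗ LinearMap.mul' k H)
    ∘ₗ (TensorProduct.assoc k H H H).toLinearMap
    ∘ₗ LinearMap.rTensor H (TensorProduct.comm k H H).toLinearMap
    ∘ₗ TensorProduct.mk k (H ⊗[k] H) H (W.δ 1)

/-- The source map `Π^R_H = (H⊗(ε∘μ))∘(c⊗H)∘(H⊗(δ∘η))`. -/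
def PiR (W : HopfData k H) : H →ₗ[k] H :=
  (TensorProduct.lid k H).toLinearMap
    ∘ₗ LinearMap.rTensor H (W.ε ∘ₗ LinearMap.mul' k H)
    ∘ₗ (TensorProduct.assoc k H H H).symm.toLinearMap
    ∘ₗ LinearMap.lTensor H (TensorProduct.comm k H H).toLinearMap
    ∘ₗ (TensorProduct.mk k H (H ⊗[k] H)).flip (W.δ 1)

/-- `H` together with the data `W` is a weak Hopf algebra. -/
structure IsWeakHopf (W : HopfData k H) : Prop where
  coassoc : ∀ h : H,
    (TensorProduct.assoc k H H H) ((LinearMap.rTensor H W.δ) (W.δ h)) =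
      (LinearMap.lTensor H W.δ) (W.δ h)
  counit_left : ∀ h : H, (TensorProduct.lid k H) ((LinearMap.rTensor H W.ε) (W.δ h)) = h
  counit_right : ∀ h : H, (TensorProduct.rid k H) ((LinearMap.lTensor H W.ε) (W.δ h)) = h
  a1 : ∀ x y : H, W.δ (x * y) = W.δ x * W.δ y
  a2 : ∀ x y z : H, W.ε (x * y * z) =
    LinearMap.mul' k k ((TensorProduct.map (W.ε ∘ₗ LinearMap.mulLeft k x)
      (W.ε ∘ₗ LinearMap.mulRight k z)) (W.δ y))
  a2' : ∀ x y z : H, W.ε (x * y * z) =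
    LinearMap.mul' k k ((TensorProduct.map (W.ε ∘ₗ LinearMap.mulLeft k x)
      (W.ε ∘ₗ LinearMap.mulRight k z)) ((TensorProduct.comm k H H) (W.δ y)))
  a3 : (TensorProduct.assoc k H H H) ((LinearMap.rTensor H W.δ) (W.δ 1)) =
    (TensorProduct.map LinearMap.id
        (Algebra.TensorProduct.includeLeft : H →ₐ[k] H ⊗[k] H).toLinearMap) (W.δ 1) *
      (Algebra.TensorProduct.includeRight : (H ⊗[k] H) →ₐ[k] H ⊗[k] (H ⊗[k] H)).toLinearMap
        (W.δ 1)
  a3' : (TensorProduct.assoc k H H H) ((LinearMap.rTensor H W.δ) (W.δ 1)) =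
    (Algebra.TensorProduct.includeRight : (H ⊗[k] H) →ₐ[k] H ⊗[k] (H ⊗[k] H)).toLinearMap
        (W.δ 1) *
      (TensorProduct.map LinearMap.id
        (Algebra.TensorProduct.includeLeft : H →ₐ[k] H ⊗[k] H).toLinearMap) (W.δ 1)
  a4_left : ∀ h : H,
    LinearMap.mul' k H ((TensorProduct.map LinearMap.id W.lam) (W.δ h)) = PiL W h
  a4_right : ∀ h : H,
    LinearMap.mul' k H ((TensorProduct.map W.lam LinearMap.id) (W.δ h)) = PiR W h
  a4_mid : conv k W.δ (conv k W.δ W.lam LinearMap.id) W.lam = W.lam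

/-- `H` is cocommutative. -/
def Cocomm (W : HopfData k H) : Prop :=
  ∀ h : H, (TensorProduct.comm k H H) (W.δ h) = W.δ h

section ComodAlg

variable {A : Type} [Ring A] [Algebra k A]

/-- The map `ζ_A = (μ_A⊗H)∘(A⊗c_{H,A})∘((ρ_A∘η_A)⊗A)`; in the tensor product
algebra `A ⊗ H` it is given by `a ↦ ρ(1) * (a ⊗ 1)`. -/
def zeta (ρ : A →ₗ[k] A ⊗[k] H) (a : A) : A ⊗[k] H :=
  ρ 1 * (a ⊗ₜ[k] (1 : H))

/-- `a` is a coinvariant element, i.e. belongs to `A_H`. -/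
def IsCoinv (ρ : A →ₗ[k] A ⊗[k] H) (a : A) : Prop :=
  ρ a = zeta ρ a

/-- `(A, ρ)` is a right `H`-comodule algebra. -/
structure IsComodAlg (W : HopfData k H) (ρ : A →ₗ[k] A ⊗[k] H) : Prop where
  coassoc : ∀ a : A, (TensorProduct.assoc k A H H) ((LinearMap.rTensor H ρ) (ρ a)) =
    (LinearMap.lTensor A W.δ) (ρ a)
  counit : ∀ a : A, (TensorProduct.rid k A) ((LinearMap.lTensor A W.ε) (ρ a)) = a
  mul_compat : ∀ a b : A, ρ (a * b) = ρ a * ρ b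
  unit_coinv : (LinearMap.lTensor A (PiL W)) (ρ 1) = ρ 1

end ComodAlg

/-- For `t = Σ x ⊗ y : B ⊗ H`, the map `h ↦ Σ ε(h*y) • x`.  For
`t = ρ(1)` this is the map `e_A = (A⊗ε)∘Γ∘(H⊗η)`. -/
def eGen (W : HopfData k H) {B : Type} [AddCommGroup B] [Module k B]
    (t : B ⊗[k] H) : H →ₗ[k] B :=
  (TensorProduct.lid k B).toLinearMap
    ∘ₗ LinearMap.rTensor B (W.ε ∘ₗ LinearMap.mul' k H)
    ∘ₗ (TensorProduct.assoc k H H B).symm.toLinearMap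
    ∘ₗ LinearMap.lTensor H (TensorProduct.comm k B H).toLinearMap
    ∘ₗ (TensorProduct.mk k H (B ⊗[k] H)).flip t

/-- For `t = Σ x ⊗ y : B ⊗ H`, the map `h ↦ Σ ε(y*h) • x`.  For
`t = ρ(1)` this is the map `(A⊗(ε∘μ))∘((ρ∘η)⊗H)`. -/
def dGen (W : HopfData k H) {B : Type} [AddCommGroup B] [Module k B]
    (t : B ⊗[k] H) : H →ₗ[k] B :=
  (TensorProduct.rid k B).toLinearMap
    ∘ₗ LinearMap.lTensor B (W.ε ∘ₗ LinearMap.mul' k H)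
    ∘ₗ (TensorProduct.assoc k B H H).toLinearMap
    ∘ₗ TensorProduct.mk k (B ⊗[k] H) H t

section ComodAlg2

variable {A : Type} [Ring A] [Algebra k A]

/-- The entwining map `Γ_A^H = (A⊗μ_H)∘(c_{H,A}⊗H)∘(H⊗ρ_A)`. -/
def Γmap (ρ : A →ₗ[k] A ⊗[k] H) : H ⊗[k] A →ₗ[k] A ⊗[k] H :=
  LinearMap.lTensor A (LinearMap.mul' k H)
    ∘ₗ (TensorProduct.assoc k A H H).toLinearMap
    ∘ₗ LinearMap.rTensor H (TensorProduct.comm k H A).toLinearMap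
    ∘ₗ (TensorProduct.assoc k H A H).symm.toLinearMap
    ∘ₗ LinearMap.lTensor H ρ

/-- `f : H → A` is an integral, i.e. a morphism of right `H`-comodules. -/
def IsIntegral (W : HopfData k H) (ρ : A →ₗ[k] A ⊗[k] H) (f : H →ₗ[k] A) : Prop :=
  ∀ h : H, ρ (f h) = (LinearMap.rTensor H f) (W.δ h)

/-- `finv` is the convolution inverse of the integral `f` (conditions (c1)-(c3)). -/
def IsConvInv (W : HopfData k H) (ρ : A →ₗ[k] A ⊗[k] H) (f finv : H →ₗ[k] A) : Prop :=
  conv k W.δ finv f = eGen W (ρ 1) ∧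
  conv k W.δ f finv = dGen W (ρ 1) ∧
  conv k W.δ (conv k W.δ finv f) finv = finv

/-- `f` is a cleaving morphism (with convolution inverse `finv`) for the extension
`A_H ↪ A`, i.e. a convolution invertible integral such that `f ∧ f⁻¹` takes
values in the coinvariants. -/
def IsCleaving (W : HopfData k H) (ρ : A →ₗ[k] A ⊗[k] H) (f finv : H →ₗ[k] A) : Prop :=
  IsIntegral W ρ f ∧ IsConvInv W ρ f finv ∧
    ∀ h : H, IsCoinv ρ (conv k W.δ f finv h)

end ComodAlg2

section ModAlg

variable {B : Type} [Ring B] [Algebra k B]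

/-- `u₁ = φ ∘ (H ⊗ η_B)`. -/
def u1 (φ : H ⊗[k] B →ₗ[k] B) : H →ₗ[k] B :=
  φ ∘ₗ (TensorProduct.mk k H B).flip 1

/-- `u₂ = u₁ ∘ μ_H`. -/
def u2 (φ : H ⊗[k] B →ₗ[k] B) : H ⊗[k] H →ₗ[k] B :=
  u1 φ ∘ₗ LinearMap.mul' k H

/-- `(B, φ)` is a weak left `H`-module algebra (conditions (d1)-(d4)). -/
def IsWeakModAlg (W : HopfData k H) (φ : H ⊗[k] B →ₗ[k] B) : Prop :=
  (∀ b : B, φ ((1 : H) ⊗ₜ[k] b) = b) ∧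
  (∀ (h : H) (b c : B), φ (h ⊗ₜ[k] (b * c)) =
    LinearMap.mul' k B ((TensorProduct.map (φ ∘ₗ (TensorProduct.mk k H B).flip b)
      (φ ∘ₗ (TensorProduct.mk k H B).flip c)) (W.δ h))) ∧
  (∀ g h : H, φ ((g * h) ⊗ₜ[k] (1 : B)) = φ (g ⊗ₜ[k] φ (h ⊗ₜ[k] (1 : B)))) ∧
  (∀ (h : H) (b : B), φ (PiL W h ⊗ₜ[k] b) = φ (h ⊗ₜ[k] (1 : B)) * b)

/-- `(B, φ)` is a left `H`-module algebra. -/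
def IsModAlg (W : HopfData k H) (φ : H ⊗[k] B →ₗ[k] B) : Prop :=
  IsWeakModAlg W φ ∧
    ∀ (g h : H) (b : B), φ ((g * h) ⊗ₜ[k] b) = φ (g ⊗ₜ[k] φ (h ⊗ₜ[k] b))

/-- `(h, hinv)` is a pair of mutually convolution inverse elements in
`Reg_{φ}(H,B)`. -/
def IsRegPair (W : HopfData k H) (φ : H ⊗[k] B →ₗ[k] B) (h hinv : H →ₗ[k] B) : Prop :=
  conv k W.δ h hinv = u1 φ ∧ conv k W.δ hinv h = u1 φ ∧
  conv k W.δ (conv k W.δ h hinv) h = h ∧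
  conv k W.δ (conv k W.δ hinv h) hinv = hinv

end ModAlg

/-- The comultiplication of the tensor product coalgebra `H ⊗ H`. -/
def δ2 (W : HopfData k H) : H ⊗[k] H →ₗ[k] (H ⊗[k] H) ⊗[k] (H ⊗[k] H) :=
  (TensorProduct.tensorTensorTensorComm k H H H H).toLinearMap
    ∘ₗ TensorProduct.map W.δ W.δ

/-- The comultiplication of the tensor product coalgebra `H ⊗ (H ⊗ H)`. -/
def δ3 (W : HopfData k H) :
    H ⊗[k] (H ⊗[k] H) →ₗ[k] (H ⊗[k] (H ⊗[k] H)) ⊗[k] (H ⊗[k] (H ⊗[k] H)) :=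
  (TensorProduct.tensorTensorTensorComm k H H (H ⊗[k] H) (H ⊗[k] H)).toLinearMap
    ∘ₗ TensorProduct.map W.δ (δ2 W)

section ModAlg2

variable {B : Type} [Ring B] [Algebra k B]

/-- `(σ, σinv)` is a pair of mutually convolution inverse elements in
`Reg_{φ}(H⊗H,B)`. -/
def IsRegPair2 (W : HopfData k H) (φ : H ⊗[k] B →ₗ[k] B)
    (σ σinv : H ⊗[k] H →ₗ[k] B) : Prop :=
  conv k (δ2 W) σ σinv = u2 φ ∧ conv k (δ2 W) σinv σ = u2 φ ∧
  conv k (δ2 W) (conv k (δ2 W) σ σinv) σ = σ ∧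
  conv k (δ2 W) (conv k (δ2 W) σinv σ) σinv = σinv

/-- Condition (g1) (the twisted condition). -/
def CrossedG1 (W : HopfData k H) (φ : H ⊗[k] B →ₗ[k] B) (σ : H ⊗[k] H →ₗ[k] B) : Prop :=
  ∀ (x y : H) (b : B),
    LinearMap.mul' k B ((TensorProduct.map σ
        ((φ ∘ₗ (TensorProduct.mk k H B).flip b) ∘ₗ LinearMap.mul' k H))
      (δ2 W (x ⊗ₜ[k] y))) =
    LinearMap.mul' k B ((TensorProduct.map
        (φ ∘ₗ LinearMap.lTensor H (φ ∘ₗ (TensorProduct.mk k H B).flip b)) σ)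
      (δ2 W (x ⊗ₜ[k] y)))

/-- Condition (g2) (the cocycle condition). -/
def CrossedG2 (W : HopfData k H) (φ : H ⊗[k] B →ₗ[k] B) (σ : H ⊗[k] H →ₗ[k] B) : Prop :=
  conv k (δ3 W) (φ ∘ₗ LinearMap.lTensor H σ)
      (σ ∘ₗ LinearMap.lTensor H (LinearMap.mul' k H)) =
  conv k (δ3 W)
      ((TensorProduct.rid k B).toLinearMap ∘ₗ TensorProduct.map σ W.ε
        ∘ₗ (TensorProduct.assoc k H H H).symm.toLinearMap)
      (σ ∘ₗ LinearMap.rTensor H (LinearMap.mul' k H)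
        ∘ₗ (TensorProduct.assoc k H H H).symm.toLinearMap)

/-- Condition (g3) (the normal condition). -/
def CrossedG3 (W : HopfData k H) (φ : H ⊗[k] B →ₗ[k] B) (σ : H ⊗[k] H →ₗ[k] B) : Prop :=
  ∀ h : H, σ (h ⊗ₜ[k] (1 : H)) = u1 φ h ∧ σ ((1 : H) ⊗ₜ[k] h) = u1 φ h

/-- `(φ, σ)` is a crossed system for `H` over `B`, with `σinv` the convolution
inverse of `σ`. -/
def IsCrossedSystem (W : HopfData k H) (φ : H ⊗[k] B →ₗ[k] B)
    (σ σinv : H ⊗[k] H →ₗ[k] B) : Prop :=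
  IsWeakModAlg W φ ∧ IsRegPair2 W φ σ σinv ∧
    CrossedG1 W φ σ ∧ CrossedG2 W φ σ ∧ CrossedG3 W φ σ

/-- The condition that `h` conjugates the weak action `ϕ` into `φ`. -/
def FisEq (W : HopfData k H) (φ ϕ : H ⊗[k] B →ₗ[k] B) (h hinv : H →ₗ[k] B) : Prop :=
  ∀ (g : H) (b : B), φ (g ⊗ₜ[k] b) =
    (LinearMap.mul' k B ∘ₗ LinearMap.rTensor B (LinearMap.mul' k B))
      ((TensorProduct.map (TensorProduct.map h (ϕ ∘ₗ (TensorProduct.mk k H B).flip b)) hinv)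
        ((LinearMap.rTensor H W.δ) (W.δ g)))

/-- The condition that `h` transforms the cocycle `τ` into `σ`. -/
def SigmasEq (W : HopfData k H) (ϕ : H ⊗[k] B →ₗ[k] B)
    (σ τ : H ⊗[k] H →ₗ[k] B) (h hinv : H →ₗ[k] B) : Prop :=
  σ = conv k (δ2 W)
    (LinearMap.mul' k B ∘ₗ TensorProduct.map h ϕ
      ∘ₗ (TensorProduct.assoc k H H B).toLinearMap ∘ₗ TensorProduct.map W.δ h)
    (conv k (δ2 W) τ (hinv ∘ₗ LinearMap.mul' k H))

/-- `h` (with convolution inverse `hinv`) realizes an equivalence between the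
crossed systems `(φ, σ)` and `(ϕ, τ)`. -/
def RealizesEquiv (W : HopfData k H) (φ ϕ : H ⊗[k] B →ₗ[k] B)
    (σ τ : H ⊗[k] H →ₗ[k] B) (h hinv : H →ₗ[k] B) : Prop :=
  IsRegPair W φ h hinv ∧ IsRegPair W ϕ h hinv ∧ h 1 = 1 ∧
    FisEq W φ ϕ h hinv ∧ SigmasEq W ϕ σ τ h hinv

/-- The crossed systems `(φ, σ)` and `(ϕ, τ)` are equivalent. -/
def CrossedEquiv (W : HopfData k H) (φ ϕ : H ⊗[k] B →ₗ[k] B)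
    (σ τ : H ⊗[k] H →ₗ[k] B) : Prop :=
  u1 φ = u1 ϕ ∧ ∃ h hinv : H →ₗ[k] B, RealizesEquiv W φ ϕ σ τ h hinv

/-- The map `ψ_H^B = (φ⊗H)∘(H⊗c_{H,B})∘(δ_H⊗B)`. -/
def ψmap (W : HopfData k H) (φ : H ⊗[k] B →ₗ[k] B) : H ⊗[k] B →ₗ[k] B ⊗[k] H :=
  LinearMap.rTensor H φ
    ∘ₗ (TensorProduct.assoc k H B H).symm.toLinearMap
    ∘ₗ LinearMap.lTensor H (TensorProduct.comm k H B).toLinearMap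
    ∘ₗ (TensorProduct.assoc k H H B).toLinearMap
    ∘ₗ LinearMap.rTensor B W.δ

/-- The map `σ_H^B = (σ⊗μ_H)∘δ_{H⊗H}`. -/
def σHA (W : HopfData k H) (σ : H ⊗[k] H →ₗ[k] B) : H ⊗[k] H →ₗ[k] B ⊗[k] H :=
  TensorProduct.map σ (LinearMap.mul' k H) ∘ₗ δ2 W

/-- The idempotent `∇_{B⊗H} = (μ_B⊗H)∘(B⊗ψ_H^B)∘(B⊗H⊗η_B)`. -/
def nabla (W : HopfData k H) (φ : H ⊗[k] B →ₗ[k] B) : B ⊗[k] H →ₗ[k] B ⊗[k] H :=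
  LinearMap.rTensor H (LinearMap.mul' k B)
    ∘ₗ (TensorProduct.assoc k B B H).symm.toLinearMap
    ∘ₗ LinearMap.lTensor B (ψmap W φ)
    ∘ₗ LinearMap.lTensor B ((TensorProduct.mk k H B).flip 1)

/-- The product `(μ_B⊗H)∘(μ_B⊗σ_H^B)∘(B⊗ψ_H^B⊗H)` on `B ⊗ H`. -/
def crossmulAmb (W : HopfData k H) (φ : H ⊗[k] B →ₗ[k] B) (σ : H ⊗[k] H →ₗ[k] B) :
    (B ⊗[k] H) ⊗[k] (B ⊗[k] H) →ₗ[k] B ⊗[k] H :=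
  LinearMap.rTensor H (LinearMap.mul' k B)
    ∘ₗ (TensorProduct.assoc k B B H).symm.toLinearMap
    ∘ₗ LinearMap.lTensor B (LinearMap.rTensor H (LinearMap.mul' k B))
    ∘ₗ LinearMap.lTensor B ((TensorProduct.assoc k B B H).symm.toLinearMap)
    ∘ₗ LinearMap.lTensor B (LinearMap.lTensor B (σHA W σ))
    ∘ₗ LinearMap.lTensor B ((TensorProduct.assoc k B H H).toLinearMap)
    ∘ₗ LinearMap.lTensor B (LinearMap.rTensor H (ψmap W φ))
    ∘ₗ LinearMap.lTensor B ((TensorProduct.assoc k H B H).symm.toLinearMap)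
    ∘ₗ (TensorProduct.assoc k B H (B ⊗[k] H)).toLinearMap

end ModAlg2

section CrossProd

variable {B : Type} [Ring B] [Algebra k B]
variable {P : Type} [AddCommGroup P] [Module k P]

/-- The product of the weak crossed product `B ×_σ H`, through a splitting
`(P, p, ι)` of the idempotent `∇_{B⊗H}`. -/
def crossMul (W : HopfData k H) (φ : H ⊗[k] B →ₗ[k] B) (σ : H ⊗[k] H →ₗ[k] B)
    (p : B ⊗[k] H →ₗ[k] P) (ι : P →ₗ[k] B ⊗[k] H) : P ⊗[k] P →ₗ[k] P :=
  p ∘ₗ crossmulAmb W φ σ ∘ₗ TensorProduct.map ι ι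

/-- The unit of the weak crossed product `B ×_σ H`. -/
def crossUnit (W : HopfData k H) (φ : H ⊗[k] B →ₗ[k] B)
    (p : B ⊗[k] H →ₗ[k] P) : P :=
  p (nabla W φ ((1 : B) ⊗ₜ[k] (1 : H)))

/-- The coaction `ρ_{B×H} = (p⊗H)∘(B⊗δ_H)∘ι` of the weak crossed product. -/
def crossCoact (W : HopfData k H)
    (p : B ⊗[k] H →ₗ[k] P) (ι : P →ₗ[k] B ⊗[k] H) : P →ₗ[k] P ⊗[k] H :=
  LinearMap.rTensor H p ∘ₗ (TensorProduct.assoc k B H H).symm.toLinearMap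
    ∘ₗ LinearMap.lTensor B W.δ ∘ₗ ι

/-- The inclusion `i_{B×H} = p∘(B⊗η_H) : B → B × H`. -/
def crossInc (p : B ⊗[k] H →ₗ[k] P) : B →ₗ[k] P :=
  p ∘ₗ (TensorProduct.mk k B H).flip 1

/-- The analogue of `ζ` for an abstract module `P` with product `m`:
`ζ(x) = t · (x ⊗ 1)` where `t` plays the role of `ρ(1)`. -/
def zetaGen (m : P ⊗[k] P →ₗ[k] P) (t : P ⊗[k] H) (x : P) : P ⊗[k] H :=
  (TensorProduct.map m (LinearMap.mul' k H))
    ((TensorProduct.tensorTensorTensorComm k P H P H) (t ⊗ₜ[k] (x ⊗ₜ[k] (1 : H))))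

end CrossProd

section Induced

variable {D P : Type} [AddCommGroup D] [Module k D] [AddCommGroup P] [Module k P]

/-- The map `(P⊗P)⊗P → P`, `(x⊗y)⊗z ↦ x·(z·y)`. -/
def mulSwizG (m : P ⊗[k] P →ₗ[k] P) : (P ⊗[k] P) ⊗[k] P →ₗ[k] P :=
  m ∘ₗ LinearMap.lTensor P (m ∘ₗ (TensorProduct.comm k P P).toLinearMap)
    ∘ₗ (TensorProduct.assoc k P P P).toLinearMap

/-- The ambient weak action `μ∘(P⊗(μ∘c))∘(((f⊗f⁻¹)∘δ_H)⊗j) : H ⊗ D → P`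
induced by a cleaving morphism `f`. -/
def phiAmb (W : HopfData k H) (m : P ⊗[k] P →ₗ[k] P) (f finv : H →ₗ[k] P)
    (j : D →ₗ[k] P) : H ⊗[k] D →ₗ[k] P :=
  mulSwizG m ∘ₗ TensorProduct.map ((TensorProduct.map f finv) ∘ₗ W.δ) j

/-- The ambient cocycle `(μ∘(f⊗f)) ∧ (f⁻¹∘μ_H) : H ⊗ H → P` induced by a
cleaving morphism `f`. -/
def sigmaAmb (W : HopfData k H) (m : P ⊗[k] P →ₗ[k] P) (f finv : H →ₗ[k] P) :
    H ⊗[k] H →ₗ[k] P :=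
  convG k (δ2 W) m (m ∘ₗ TensorProduct.map f f) (finv ∘ₗ LinearMap.mul' k H)

end Induced

section Pres

variable {A D : Type} [Ring A] [Algebra k A] [Ring D] [Algebra k D]

/-- `j : D → A` presents `D` as the subalgebra of coinvariants of `A`. -/
def IsCoinvPres (ρ : A →ₗ[k] A ⊗[k] H) (j : D →ₐ[k] A) : Prop :=
  Function.Injective j ∧ ∀ a : A, IsCoinv ρ a ↔ a ∈ Set.range j

end Pres

section Auxiliary

/-- The convolution of `F : M → A` and `G : C → A`, where `M` is a right `C`-comodule via `ρM`. -/
def dot {M C A : Type} [AddCommGroup M] [Module k M] [AddCommGroup C] [Module k C]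
    [Ring A] [Algebra k A] (ρM : M →ₗ[k] M ⊗[k] C) (F : M →ₗ[k] A) (G : C →ₗ[k] A) :
    M →ₗ[k] A :=
  LinearMap.mul' k A ∘ₗ TensorProduct.map F G ∘ₗ ρM

lemma dot_assoc {M C A : Type} [AddCommGroup M] [Module k M] [AddCommGroup C] [Module k C]
    [Ring A] [Algebra k A] {ρM : M →ₗ[k] M ⊗[k] C} {δC : C →ₗ[k] C ⊗[k] C}
    (hco : ∀ m, (TensorProduct.assoc k M C C) ((LinearMap.rTensor C ρM) (ρM m)) =
      (LinearMap.lTensor M δC) (ρM m))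
    (F : M →ₗ[k] A) (G G' : C →ₗ[k] A) :
    dot ρM (dot ρM F G) G' = dot ρM F (conv k δC G G') := by
  ext m
  have h1 : ∀ t : M ⊗[k] C, LinearMap.mul' k A (TensorProduct.map (dot ρM F G) G' t) =
      (LinearMap.mul' k A ∘ₗ TensorProduct.map F (LinearMap.mul' k A ∘ₗ TensorProduct.map G G'))
        ((TensorProduct.assoc k M C C) ((LinearMap.rTensor C ρM) t)) := by
    intro t
    induction t with
    | zero => simp
    | add a b ha hb => simp only [map_add, ha, hb]
    | tmul m c =>
      simp only [TensorProduct.map_tmul, LinearMap.rTensor_tmul, LinearMap.mul'_apply, dot,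
        LinearMap.comp_apply]
      induction ρM m with
      | zero => simp
      | add a b ha hb => simp only [map_add, add_tmul, add_mul, ha, hb]
      | tmul p q => simp [mul_assoc]
  have h2 : ∀ t : M ⊗[k] C, LinearMap.mul' k A (TensorProduct.map F (conv k δC G G') t) =
      (LinearMap.mul' k A ∘ₗ TensorProduct.map F (LinearMap.mul' k A ∘ₗ TensorProduct.map G G'))
        ((LinearMap.lTensor M δC) t) := by
    intro t
    induction t with
    | zero => simp
    | add a b ha hb => simp only [map_add, ha, hb]
    | tmul m c => simp [conv, convG]
  change LinearMap.mul' k A (TensorProduct.map (dot ρM F G) G' (ρM m)) =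
    LinearMap.mul' k A (TensorProduct.map F (conv k δC G G') (ρM m))
  rw [h1, h2, hco]

lemma conv_assoc {C A : Type} [AddCommGroup C] [Module k C]
    [Ring A] [Algebra k A] {δC : C →ₗ[k] C ⊗[k] C}
    (hco : ∀ m, (TensorProduct.assoc k C C C) ((LinearMap.rTensor C δC) (δC m)) =
      (LinearMap.lTensor C δC) (δC m))
    (F G G' : C →ₗ[k] A) :
    conv k δC (conv k δC F G) G' = conv k δC F (conv k δC G G') :=
  dot_assoc hco F G G'

lemma comp_conv {C A B : Type} [AddCommGroup C] [Module k C]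
    [Ring A] [Algebra k A] [Ring B] [Algebra k B] (δC : C →ₗ[k] C ⊗[k] C) (j : A →ₐ[k] B)
    (F G : C →ₗ[k] A) :
    j.toLinearMap ∘ₗ conv k δC F G = conv k δC (j.toLinearMap ∘ₗ F) (j.toLinearMap ∘ₗ G) := by
  ext x
  simp only [conv, convG, LinearMap.comp_apply]
  induction δC x with
  | zero => simp
  | add a b ha hb => simp only [map_add, ha, hb]
  | tmul p q => simp

/-- The comultiplication of `H ⊗ H` is coassociative. -/
lemma IsWeakHopf.coassoc_δ2 {W : HopfData k H} (hW : IsWeakHopf W) (t : H ⊗[k] H) :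
    (TensorProduct.assoc k _ _ _) ((LinearMap.rTensor _ (δ2 W)) (δ2 W t)) =
      (LinearMap.lTensor _ (δ2 W)) (δ2 W t) := by
  let _ : Coalgebra k H :=
    { comul := W.δ
      counit := W.ε
      coassoc := LinearMap.ext hW.coassoc
      rTensor_counit_comp_comul := by
        ext h
        apply (TensorProduct.lid k H).injective
        simpa using hW.counit_left h
      lTensor_counit_comp_comul := by
        ext h
        apply (TensorProduct.rid k H).injective
        simpa using hW.counit_right h }
  exact LinearMap.congr_fun (Coalgebra.coassoc (R := k) (A := H ⊗[k] H)) t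

/-- `μ_H` is comultiplicative, hence precomposition with it respects convolution. -/
lemma conv_comp_mul {A : Type} [Ring A] [Algebra k A] {W : HopfData k H} (hW : IsWeakHopf W)
    (F G : H →ₗ[k] A) :
    conv k (δ2 W) (F ∘ₗ LinearMap.mul' k H) (G ∘ₗ LinearMap.mul' k H) =
      conv k W.δ F G ∘ₗ LinearMap.mul' k H := by
  ext x y
  simp only [conv, convG, δ2, AlgebraTensorModule.curry_apply, LinearMap.restrictScalars_self,
    curry_apply, LinearMap.comp_apply, LinearMap.mul'_apply, hW.a1, TensorProduct.map_tmul]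
  induction W.δ x with
  | zero => simp
  | add a b ha hb => simp only [map_add, add_tmul, add_mul, ha, hb]
  | tmul p q =>
    induction W.δ y with
    | zero => simp
    | add a b ha hb => simp only [map_add, tmul_add, mul_add, ha, hb]
    | tmul r s => simp

lemma PiL_apply (W : HopfData k H) (h : H) :
    PiL W h = TensorProduct.lid k H
      (TensorProduct.map (W.ε ∘ₗ LinearMap.mulRight k h) LinearMap.id (W.δ 1)) := by
  simp only [PiL, LinearMap.comp_apply, TensorProduct.mk_apply]
  induction W.δ 1 with
  | zero => simp
  | add a b ha hb => simp only [map_add, add_tmul, ha, hb]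
  | tmul p q => simp

/-- Contraction of the first leg of `H ⊗ (H ⊗ H)` against `ε(- h)`. -/
def contractFirst (W : HopfData k H) (h : H) : H ⊗[k] (H ⊗[k] H) →ₗ[k] H ⊗[k] H :=
  (TensorProduct.lid k _).toLinearMap ∘ₗ
    TensorProduct.map (W.ε ∘ₗ LinearMap.mulRight k h) LinearMap.id

lemma contractFirst_coassoc {W : HopfData k H} (hW : IsWeakHopf W) (h : H) :
    contractFirst W h ((TensorProduct.assoc k H H H) ((LinearMap.rTensor H W.δ) (W.δ 1))) =
      W.δ (PiL W h) := by
  rw [hW.coassoc, PiL_apply, contractFirst]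
  induction W.δ 1 with
  | zero => simp
  | add a b ha hb => simp only [map_add, ha, hb]
  | tmul p q => simp

lemma comul_PiL {W : HopfData k H} (hW : IsWeakHopf W) (h : H) :
    W.δ (PiL W h) = (PiL W h ⊗ₜ[k] 1) * W.δ 1 := by
  rw [← contractFirst_coassoc hW, hW.a3, PiL_apply, contractFirst]
  suffices key : ∀ s t : H ⊗[k] H, ((TensorProduct.lid k _).toLinearMap ∘ₗ
      TensorProduct.map (W.ε ∘ₗ LinearMap.mulRight k h) LinearMap.id)
      ((TensorProduct.map LinearMap.id
        (Algebra.TensorProduct.includeLeft : H →ₐ[k] H ⊗[k] H).toLinearMap) s *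
      (Algebra.TensorProduct.includeRight : (H ⊗[k] H) →ₐ[k] H ⊗[k] (H ⊗[k] H)).toLinearMap t) =
      (TensorProduct.lid k H
        (TensorProduct.map (W.ε ∘ₗ LinearMap.mulRight k h) LinearMap.id s) ⊗ₜ[k] 1) * t from
    key _ _
  intro s t
  induction s with
  | zero => simp
  | add a b ha hb => simp only [map_add, add_tmul, add_mul, ha, hb]
  | tmul p q => simp [← TensorProduct.smul_tmul']

lemma comul_PiL_eq_mul {W : HopfData k H} (hW : IsWeakHopf W) (h : H) :
    W.δ (PiL W h) = W.δ 1 * (PiL W h ⊗ₜ[k] 1) := by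
  rw [← contractFirst_coassoc hW, hW.a3', PiL_apply, contractFirst]
  suffices key : ∀ s t : H ⊗[k] H, ((TensorProduct.lid k _).toLinearMap ∘ₗ
      TensorProduct.map (W.ε ∘ₗ LinearMap.mulRight k h) LinearMap.id)
      ((Algebra.TensorProduct.includeRight : (H ⊗[k] H) →ₐ[k] H ⊗[k] (H ⊗[k] H)).toLinearMap t *
      (TensorProduct.map LinearMap.id
        (Algebra.TensorProduct.includeLeft : H →ₐ[k] H ⊗[k] H).toLinearMap) s) =
      t * (TensorProduct.lid k H
        (TensorProduct.map (W.ε ∘ₗ LinearMap.mulRight k h) LinearMap.id s) ⊗ₜ[k] 1) from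
    key _ _
  intro s t
  induction s with
  | zero => simp
  | add a b ha hb => simp only [map_add, add_tmul, mul_add, ha, hb]
  | tmul p q => simp [← TensorProduct.smul_tmul']

/-- The map `h ↦ ε(h 1₁) 1₂`. -/
def PiRbar (W : HopfData k H) : H →ₗ[k] H :=
  (TensorProduct.lid k H).toLinearMap ∘ₗ LinearMap.rTensor H W.ε ∘ₗ
    LinearMap.mulRight k (W.δ 1) ∘ₗ (TensorProduct.mk k H H).flip 1

lemma PiL_eq_counit_mul (W : HopfData k H) (h : H) :
    PiL W h = TensorProduct.lid k H (LinearMap.rTensor H W.ε (W.δ 1 * (h ⊗ₜ[k] 1))) := by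
  rw [PiL_apply]
  induction W.δ 1 with
  | zero => simp
  | add a b ha hb => simp only [map_add, add_mul, ha, hb]
  | tmul p q => simp

lemma PiRbar_apply (W : HopfData k H) (h : H) :
    PiRbar W h = TensorProduct.lid k H (LinearMap.rTensor H W.ε ((h ⊗ₜ[k] 1) * W.δ 1)) := rfl

lemma PiL_PiL {W : HopfData k H} (hW : IsWeakHopf W) (h : H) : PiL W (PiL W h) = PiL W h := by
  rw [PiL_eq_counit_mul, ← comul_PiL_eq_mul hW, hW.counit_left]

lemma PiRbar_PiL {W : HopfData k H} (hW : IsWeakHopf W) (h : H) :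
    PiRbar W (PiL W h) = PiL W h := by
  rw [PiRbar_apply, ← comul_PiL hW, hW.counit_left]

section Coinvariants

variable {A : Type} [Ring A] [Algebra k A] {W : HopfData k H} {ρ : A →ₗ[k] A ⊗[k] H}

/-- The map `A ⊗ (H ⊗ H) → A ⊗ H` applying the counit to the middle factor. -/
def counitMid (A : Type) [Ring A] [Algebra k A] (W : HopfData k H) :
    A ⊗[k] (H ⊗[k] H) →ₗ[k] A ⊗[k] H :=
  LinearMap.lTensor A ((TensorProduct.lid k H).toLinearMap ∘ₗ LinearMap.rTensor H W.ε)

lemma counitMid_coaction (hρ : IsComodAlg W ρ) (t : A ⊗[k] H) :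
    counitMid A W (TensorProduct.assoc k A H H (LinearMap.rTensor H ρ t)) = t := by
  induction t with
  | zero => simp
  | add a b ha hb => simp only [map_add, ha, hb]
  | tmul a x =>
    conv_rhs => rw [← hρ.counit a]
    simp only [LinearMap.rTensor_tmul]
    induction ρ a with
    | zero => simp
    | add a b ha hb => simp only [map_add, add_tmul, ha, hb]
    | tmul p q => simp [counitMid, TensorProduct.smul_tmul']

lemma assoc_mul_tmul (s t : A ⊗[k] H) (x y : H) :
    TensorProduct.assoc k A H H ((s * t) ⊗ₜ[k] (x * y)) =
      TensorProduct.assoc k A H H (s ⊗ₜ[k] x) * TensorProduct.assoc k A H H (t ⊗ₜ[k] y) := by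
  induction s with
  | zero => simp
  | add a b ha hb => simp only [map_add, add_mul, add_tmul, ha, hb]
  | tmul p q =>
    induction t with
    | zero => simp
    | add a b ha hb => simp only [map_add, mul_add, add_tmul, ha, hb]
    | tmul r s => simp

lemma zeta_eq_PiL (hW : IsWeakHopf W) (hρ : IsComodAlg W ρ) (a : A) :
    zeta ρ a = LinearMap.lTensor A (PiL W) (ρ a) := by
  have h1 : ∀ t : A ⊗[k] H, TensorProduct.assoc k A H H
      (LinearMap.rTensor H ρ (t * (a ⊗ₜ[k] 1))) =
      TensorProduct.assoc k A H H (LinearMap.rTensor H ρ t) *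
        TensorProduct.assoc k A H H (ρ a ⊗ₜ[k] 1) := by
    intro t
    induction t with
    | zero => simp
    | add a b ha hb => simp only [map_add, add_mul, ha, hb]
    | tmul p q =>
      simp only [Algebra.TensorProduct.tmul_mul_tmul, LinearMap.rTensor_tmul, hρ.mul_compat]
      exact assoc_mul_tmul _ _ _ _
  have h2 : ∀ t s : A ⊗[k] H, counitMid A W (LinearMap.lTensor A W.δ
      (LinearMap.lTensor A (PiL W) t) * TensorProduct.assoc k A H H (s ⊗ₜ[k] 1)) =
      LinearMap.lTensor A (PiL W) (LinearMap.lTensor A (PiL W) t * s) := by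
    intro t s
    induction t with
    | zero => simp
    | add a b ha hb => simp only [map_add, add_mul, ha, hb]
    | tmul p q =>
      induction s with
      | zero => simp
      | add a b ha hb => simp only [map_add, mul_add, add_tmul, ha, hb]
      | tmul r s =>
        simp [counitMid, comul_PiL_eq_mul hW, PiL_eq_counit_mul W (_ * _), mul_assoc]
  rw [zeta, ← counitMid_coaction hρ (_ * _), h1, hρ.coassoc, ← hρ.unit_coinv, h2,
    hρ.unit_coinv, ← hρ.mul_compat, one_mul]

lemma mul_coaction_one_eq_PiRbar (hW : IsWeakHopf W) (hρ : IsComodAlg W ρ) (a : A) :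
    (a ⊗ₜ[k] 1) * ρ 1 = LinearMap.lTensor A (PiRbar W) (ρ a) := by
  have h1 : ∀ t : A ⊗[k] H, TensorProduct.assoc k A H H
      (LinearMap.rTensor H ρ ((a ⊗ₜ[k] 1) * t)) =
      TensorProduct.assoc k A H H (ρ a ⊗ₜ[k] 1) *
      TensorProduct.assoc k A H H (LinearMap.rTensor H ρ t) := by
    intro t
    induction t with
    | zero => simp
    | add a b ha hb => simp only [map_add, mul_add, ha, hb]
    | tmul p q =>
      simp only [Algebra.TensorProduct.tmul_mul_tmul, LinearMap.rTensor_tmul, hρ.mul_compat]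
      exact assoc_mul_tmul _ _ _ _
  have h2 : ∀ t s : A ⊗[k] H, counitMid A W (TensorProduct.assoc k A H H (s ⊗ₜ[k] 1) *
      LinearMap.lTensor A W.δ (LinearMap.lTensor A (PiL W) t)) =
      LinearMap.lTensor A (PiRbar W) (s * LinearMap.lTensor A (PiL W) t) := by
    intro t s
    induction t with
    | zero => simp
    | add a b ha hb => simp only [map_add, mul_add, ha, hb]
    | tmul p q =>
      induction s with
      | zero => simp
      | add a b ha hb => simp only [map_add, add_mul, add_tmul, ha, hb]
      | tmul r s =>
        simp [counitMid, comul_PiL hW, PiRbar_apply W (_ * _), ← mul_assoc]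
  rw [← counitMid_coaction hρ (_ * _), h1, hρ.coassoc, ← hρ.unit_coinv, h2,
    hρ.unit_coinv, ← hρ.mul_compat, mul_one]

/-- Left and right coinvariance agree. -/
lemma isCoinv_iff (hW : IsWeakHopf W) (hρ : IsComodAlg W ρ) (a : A) :
    IsCoinv ρ a ↔ ρ a = (a ⊗ₜ[k] 1) * ρ 1 := by
  have hR : PiRbar W ∘ₗ PiL W = PiL W := LinearMap.ext (PiRbar_PiL hW)
  rw [IsCoinv, zeta_eq_PiL hW hρ, mul_coaction_one_eq_PiRbar hW hρ]
  constructor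
  · intro h
    rw [h, ← LinearMap.lTensor_comp_apply, hR]
  · intro h
    have h3 : LinearMap.lTensor A (PiL W) ((a ⊗ₜ[k] 1) * ρ 1) = (a ⊗ₜ[k] 1) * ρ 1 := by
      have h4 : ∀ t : A ⊗[k] H, LinearMap.lTensor A (PiL W)
          ((a ⊗ₜ[k] 1) * LinearMap.lTensor A (PiL W) t) =
          (a ⊗ₜ[k] 1) * LinearMap.lTensor A (PiL W) t := by
        intro t
        induction t with
        | zero => simp
        | add a b ha hb => simp only [map_add, mul_add, ha, hb]
        | tmul p q => simp [PiL_PiL hW]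
      simpa only [hρ.unit_coinv] using h4 (ρ 1)
    rw [mul_coaction_one_eq_PiRbar hW hρ, ← h] at h3
    exact h3.symm

end Coinvariants


section Cleft

variable {A D : Type} [Ring A] [Algebra k A] [Ring D] [Algebra k D]
  {W : HopfData k H} {ρ : A →ₗ[k] A ⊗[k] H} {f finv : H →ₗ[k] A}

lemma mul'_lTensor_eGen (t u : A ⊗[k] H) :
    LinearMap.mul' k A (LinearMap.lTensor A (eGen W u) t) =
      TensorProduct.rid k A (LinearMap.lTensor A W.ε (t * u)) := by
  induction t with
  | zero => simp
  | add a b ha hb => simp only [map_add, add_mul, ha, hb]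
  | tmul p q =>
    simp only [eGen, LinearMap.lTensor_tmul, LinearMap.mul'_apply, LinearMap.comp_apply,
      LinearMap.flip_apply, TensorProduct.mk_apply]
    induction u with
    | zero => simp
    | add a b ha hb => simp only [map_add, mul_add, tmul_add, ha, hb]
    | tmul r s => simp

lemma mul'_lTensor_eGen_coaction (hρ : IsComodAlg W ρ) (a : A) :
    LinearMap.mul' k A (LinearMap.lTensor A (eGen W (ρ 1)) (ρ a)) = a := by
  rw [mul'_lTensor_eGen, ← hρ.mul_compat, mul_one, hρ.counit]

lemma coaction_coinv_mul (hW : IsWeakHopf W) (hρ : IsComodAlg W ρ) {c : A} (hc : IsCoinv ρ c)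
    (a : A) : ρ (c * a) = (c ⊗ₜ[k] 1) * ρ a := by
  rw [hρ.mul_compat, (isCoinv_iff hW hρ c).1 hc, mul_assoc, ← hρ.mul_compat, one_mul]

lemma conv_mulRight_eGen (hW : IsWeakHopf W) (hρ : IsComodAlg W ρ) (hf : IsIntegral W ρ f)
    {c : A} (hc : IsCoinv ρ c) :
    conv k W.δ (LinearMap.mulRight k c ∘ₗ f) (eGen W (ρ 1)) = LinearMap.mulRight k c ∘ₗ f := by
  ext x
  have h1 : ∀ t : H ⊗[k] H, TensorProduct.map (LinearMap.mulRight k c ∘ₗ f) (eGen W (ρ 1)) t =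
      LinearMap.lTensor A (eGen W (ρ 1)) (LinearMap.rTensor H f t * (c ⊗ₜ[k] 1)) := by
    intro t
    induction t with
    | zero => simp
    | add a b ha hb => simp only [map_add, add_mul, ha, hb]
    | tmul p q => simp
  simp only [conv, convG, LinearMap.comp_apply, LinearMap.mulRight_apply]
  rw [h1, mul'_lTensor_eGen, mul_assoc, ← (isCoinv_iff hW hρ c).1 hc, ← hf, ← hρ.mul_compat,
    hρ.counit]

lemma conv_eGen (hρ : IsComodAlg W ρ) (hf : IsIntegral W ρ f) :
    conv k W.δ f (eGen W (ρ 1)) = f := by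
  ext x
  have h := mul'_lTensor_eGen_coaction hρ (f x)
  rw [hf] at h
  refine Eq.trans ?_ h
  change LinearMap.mul' k A (TensorProduct.map f (eGen W (ρ 1)) (W.δ x)) =
    LinearMap.mul' k A ((LinearMap.lTensor A (eGen W (ρ 1)) ∘ₗ LinearMap.rTensor H f) (W.δ x))
  rw [LinearMap.lTensor_comp_rTensor]

lemma conv_mul_eGen (hρ : IsComodAlg W ρ) (hf : IsIntegral W ρ f) :
    conv k (δ2 W) (LinearMap.mul' k A ∘ₗ TensorProduct.map f f)
      (eGen W (ρ 1) ∘ₗ LinearMap.mul' k H) = LinearMap.mul' k A ∘ₗ TensorProduct.map f f := by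
  ext x y
  have h := mul'_lTensor_eGen_coaction hρ (f x * f y)
  rw [hρ.mul_compat, hf, hf] at h
  refine Eq.trans ?_ h
  simp only [conv, convG, δ2, AlgebraTensorModule.curry_apply, LinearMap.restrictScalars_self,
    curry_apply, LinearMap.comp_apply, TensorProduct.map_tmul]
  clear h
  induction W.δ x with
  | zero => simp
  | add a b ha hb => simp only [map_add, add_tmul, add_mul, ha, hb]
  | tmul p q =>
    induction W.δ y with
    | zero => simp
    | add a b ha hb => simp only [map_add, tmul_add, mul_add, ha, hb]
    | tmul r s => simp

lemma dot_coaction_eq_self (hρ : IsComodAlg W ρ) (hc : IsConvInv W ρ f finv) :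
    dot ρ (dot ρ LinearMap.id finv) f = LinearMap.id := by
  rw [dot_assoc (C := H) hρ.coassoc, hc.1]
  ext a
  exact mul'_lTensor_eGen_coaction hρ a

lemma dot_includeLeft_coaction {M : Type} [AddCommGroup M] [Module k M]
    {ρM : M →ₗ[k] M ⊗[k] H} (hf : IsIntegral W ρ f)
    (hco : ∀ m, (TensorProduct.assoc k M H H) ((LinearMap.rTensor H ρM) (ρM m)) =
      (LinearMap.lTensor M W.δ) (ρM m)) (F : M →ₗ[k] A) :
    dot ρM ((Algebra.TensorProduct.includeLeft : A →ₐ[k] A ⊗[k] H).toLinearMap ∘ₗ F) (ρ ∘ₗ f) =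
      LinearMap.rTensor H (dot ρM F f) ∘ₗ ρM := by
  ext m
  let Θ : M ⊗[k] (H ⊗[k] H) →ₗ[k] A ⊗[k] H :=
    LinearMap.rTensor H (LinearMap.mul' k A ∘ₗ TensorProduct.map F f) ∘ₗ
      (TensorProduct.assoc k M H H).symm.toLinearMap
  have h1 : ∀ t : M ⊗[k] H, LinearMap.mul' k _ (TensorProduct.map
      ((Algebra.TensorProduct.includeLeft : A →ₐ[k] A ⊗[k] H).toLinearMap ∘ₗ F) (ρ ∘ₗ f) t) =
      Θ (LinearMap.lTensor M W.δ t) := by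
    intro t
    induction t with
    | zero => simp
    | add a b ha hb => simp only [map_add, ha, hb]
    | tmul p q =>
      simp only [TensorProduct.map_tmul, LinearMap.comp_apply, hf q, LinearMap.lTensor_tmul]
      induction W.δ q with
      | zero => simp
      | add a b ha hb => simp only [map_add, tmul_add, ha, hb]
      | tmul r s => simp [Θ]
  have h2 : ∀ t : M ⊗[k] H, LinearMap.rTensor H (dot ρM F f) t =
      Θ (TensorProduct.assoc k M H H (LinearMap.rTensor H ρM t)) := by
    intro t
    induction t with
    | zero => simp
    | add a b ha hb => simp only [map_add, ha, hb]
    | tmul p q => simp [Θ, dot]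
  exact (h1 _).trans ((congrArg Θ (hco m)).symm.trans (h2 _).symm)

/-- For a cleaving morphism, `a ↦ a₀ f⁻¹(a₁)` takes values in the coinvariants. -/
lemma isCoinv_dot (hW : IsWeakHopf W) (hρ : IsComodAlg W ρ) (hf : IsCleaving W ρ f finv)
    (a : A) : IsCoinv ρ (dot ρ LinearMap.id finv a) := by
  obtain ⟨hi, hc, hv⟩ := hf
  rw [isCoinv_iff hW hρ]
  have hcond : ∀ h, ρ (conv k W.δ f finv h) = (conv k W.δ f finv h ⊗ₜ[k] 1) * ρ 1 :=
    fun h => (isCoinv_iff hW hρ _).1 (hv h)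
  -- work in the algebra `A ⊗ H`
  let ι : A →ₐ[k] A ⊗[k] H := Algebra.TensorProduct.includeLeft
  have hcomp : ∀ F G : H →ₗ[k] A, ρ ∘ₗ conv k W.δ F G = conv k W.δ (ρ ∘ₗ F) (ρ ∘ₗ G) := by
    intro F G
    ext x
    simp only [conv, convG, LinearMap.comp_apply]
    induction W.δ x with
    | zero => simp
    | add a b ha hb => simp only [map_add, ha, hb]
    | tmul p q => simp [hρ.mul_compat]
  have hdot : ∀ F : A →ₗ[k] A, ∀ G : H →ₗ[k] A, ρ ∘ₗ dot ρ F G = dot ρ (ρ ∘ₗ F) (ρ ∘ₗ G) := by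
    intro F G
    ext x
    simp only [dot, LinearMap.comp_apply]
    induction ρ x with
    | zero => simp
    | add a b ha hb => simp only [map_add, ha, hb]
    | tmul p q => simp [hρ.mul_compat]
  let q : A →ₗ[k] A := dot ρ LinearMap.id finv
  have h1 : ρ = dot ρ (ι.toLinearMap ∘ₗ q) (ρ ∘ₗ f) := by
    rw [dot_includeLeft_coaction hi hρ.coassoc, dot_coaction_eq_self hρ hc]
    simp
  have h2 : conv k W.δ (ρ ∘ₗ f) (ρ ∘ₗ finv) =
      LinearMap.mulRight k (ρ 1) ∘ₗ ι.toLinearMap ∘ₗ conv k W.δ f finv := by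
    rw [← hcomp]
    ext x
    exact hcond x
  have h3 : dot ρ q (conv k W.δ f finv) = q := by
    rw [dot_assoc (C := H) hρ.coassoc, ← conv_assoc hW.coassoc, hc.2.2]
  have h4 : ρ ∘ₗ q = dot ρ (ι.toLinearMap ∘ₗ q) (conv k W.δ (ρ ∘ₗ f) (ρ ∘ₗ finv)) := by
    rw [← dot_assoc (C := H) hρ.coassoc, ← h1, hdot]
    rfl
  have h5 : dot ρ (ι.toLinearMap ∘ₗ q)
      (LinearMap.mulRight k (ρ 1) ∘ₗ ι.toLinearMap ∘ₗ conv k W.δ f finv) =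
      LinearMap.mulRight k (ρ 1) ∘ₗ ι.toLinearMap ∘ₗ dot ρ q (conv k W.δ f finv) := by
    ext a
    simp only [dot, LinearMap.comp_apply]
    induction ρ a with
    | zero => simp
    | add a b ha hb => simp only [map_add, ha, hb]
    | tmul p q => simp [← mul_assoc]
  rw [h2, h5, h3] at h4
  exact LinearMap.congr_fun h4 a

section CrossedSystem

variable {φ : H ⊗[k] D →ₗ[k] D} {σ : H ⊗[k] H →ₗ[k] D} {j : D →ₐ[k] A}

lemma comp_action_eq_conv
    (hφ : j.toLinearMap ∘ₗ φ = phiAmb W (LinearMap.mul' k A) f finv j.toLinearMap) (d : D) :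
    j.toLinearMap ∘ₗ φ ∘ₗ (TensorProduct.mk k H D).flip d =
      conv k W.δ (LinearMap.mulRight k (j d) ∘ₗ f) finv := by
  ext x
  refine (LinearMap.congr_fun hφ (x ⊗ₜ[k] d)).trans ?_
  simp only [phiAmb, mulSwizG, conv, convG, LinearMap.comp_apply, TensorProduct.map_tmul]
  induction W.δ x with
  | zero => simp
  | add a b ha hb => simp only [map_add, add_tmul, ha, hb]
  | tmul r s => simp [mul_assoc]

lemma comp_u1_eq_conv
    (hφ : j.toLinearMap ∘ₗ φ = phiAmb W (LinearMap.mul' k A) f finv j.toLinearMap) :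
    j.toLinearMap ∘ₗ u1 φ = conv k W.δ f finv := by
  rw [u1, comp_action_eq_conv hφ, map_one]
  congr 1
  ext
  simp

/-- The commutation rule `φ(h₁ ⊗ d) f(h₂) = f(h) d`. -/
lemma conv_action (hW : IsWeakHopf W) (hρ : IsComodAlg W ρ) (hf : IsIntegral W ρ f)
    (hc : IsConvInv W ρ f finv) (hj : ∀ d, IsCoinv ρ (j d))
    (hφ : j.toLinearMap ∘ₗ φ = phiAmb W (LinearMap.mul' k A) f finv j.toLinearMap) (d : D) :
    conv k W.δ (j.toLinearMap ∘ₗ φ ∘ₗ (TensorProduct.mk k H D).flip d) f =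
      LinearMap.mulRight k (j d) ∘ₗ f := by
  rw [comp_action_eq_conv hφ, conv_assoc hW.coassoc, hc.1, conv_mulRight_eGen hW hρ hf (hj d)]

/-- The product rule `σ(x₁ ⊗ y₁) f(x₂ y₂) = f(x) f(y)`. -/
lemma conv_cocycle (hW : IsWeakHopf W) (hρ : IsComodAlg W ρ) (hf : IsIntegral W ρ f)
    (hc : IsConvInv W ρ f finv)
    (hσ : j.toLinearMap ∘ₗ σ = sigmaAmb W (LinearMap.mul' k A) f finv) :
    conv k (δ2 W) (j.toLinearMap ∘ₗ σ) (f ∘ₗ LinearMap.mul' k H) =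
      LinearMap.mul' k A ∘ₗ TensorProduct.map f f := by
  rw [hσ]
  change conv k (δ2 W) (conv k (δ2 W) _ _) _ = _
  rw [conv_assoc hW.coassoc_δ2, conv_comp_mul hW, hc.1, conv_mul_eGen hρ hf]

/-- Twisting the product `g(x) g(y)` by `h` gives the product of `h ∧ g` with itself. -/
lemma conv_twist (hW : IsWeakHopf W) {g : H →ₗ[k] A} (h : H →ₗ[k] D)
    (hg : ∀ d, conv k W.δ (j.toLinearMap ∘ₗ φ ∘ₗ (TensorProduct.mk k H D).flip d) g =
      LinearMap.mulRight k (j d) ∘ₗ g) :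
    conv k (δ2 W) (j.toLinearMap ∘ₗ (LinearMap.mul' k D ∘ₗ TensorProduct.map h φ
      ∘ₗ (TensorProduct.assoc k H H D).toLinearMap ∘ₗ TensorProduct.map W.δ h))
      (LinearMap.mul' k A ∘ₗ TensorProduct.map g g) =
    LinearMap.mul' k A ∘ₗ TensorProduct.map (conv k W.δ (j.toLinearMap ∘ₗ h) g)
      (conv k W.δ (j.toLinearMap ∘ₗ h) g) := by
  set L := LinearMap.mul' k D ∘ₗ TensorProduct.map h φ
      ∘ₗ (TensorProduct.assoc k H H D).toLinearMap ∘ₗ TensorProduct.map W.δ h with hL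
  have h1 : ∀ p, j.toLinearMap ∘ₗ L ∘ₗ (TensorProduct.mk k H H).flip p =
      conv k W.δ (j.toLinearMap ∘ₗ h)
        (j.toLinearMap ∘ₗ φ ∘ₗ (TensorProduct.mk k H D).flip (h p)) := by
    intro p
    rw [← comp_conv]
    ext x
    simp only [hL, conv, convG, LinearMap.comp_apply, LinearMap.flip_apply,
      TensorProduct.mk_apply, TensorProduct.map_tmul]
    induction W.δ x with
    | zero => simp
    | add a b ha hb => simp only [map_add, add_tmul, ha, hb]
    | tmul r s => simp
  have h2 : ∀ p, conv k W.δ (j.toLinearMap ∘ₗ L ∘ₗ (TensorProduct.mk k H H).flip p) g =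
      LinearMap.mulRight k (j (h p)) ∘ₗ conv k W.δ (j.toLinearMap ∘ₗ h) g := by
    intro p
    rw [h1, conv_assoc hW.coassoc, hg]
    ext x
    simp only [conv, convG, LinearMap.comp_apply]
    induction W.δ x with
    | zero => simp
    | add a b ha hb => simp only [map_add, ha, hb]
    | tmul r s => simp [mul_assoc]
  ext x y
  have h3 : ∀ t : H ⊗[k] H, LinearMap.mul' k A (TensorProduct.map (j.toLinearMap ∘ₗ L)
      (LinearMap.mul' k A ∘ₗ TensorProduct.map g g)
        (TensorProduct.tensorTensorTensorComm k H H H H (W.δ x ⊗ₜ[k] t))) =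
      conv k W.δ (j.toLinearMap ∘ₗ h) g x *
        LinearMap.mul' k A (TensorProduct.map (j.toLinearMap ∘ₗ h) g t) := by
    intro t
    induction t with
    | zero => simp
    | add a b ha hb => simp only [map_add, tmul_add, mul_add, ha, hb]
    | tmul p q =>
      have h4 : conv k W.δ (j.toLinearMap ∘ₗ h) g x * j (h p) = _ :=
        (LinearMap.congr_fun (h2 p) x).symm
      simp only [TensorProduct.map_tmul, LinearMap.mul'_apply, LinearMap.comp_apply,
        AlgHom.toLinearMap_apply]
      rw [← mul_assoc, h4]
      simp only [conv, convG, LinearMap.comp_apply]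
      induction W.δ x with
      | zero => simp
      | add a b ha hb => simp only [map_add, add_tmul, add_mul, ha, hb]
      | tmul r s => simp [mul_assoc]
  exact h3 (W.δ y)

end CrossedSystem

end Cleft

section Equivalence

variable {A B D : Type} [Ring A] [Algebra k A] [Ring B] [Algebra k B] [Ring D] [Algebra k D]
  {W : HopfData k H} {ρ : A →ₗ[k] A ⊗[k] H} {f finv g ginv : H →ₗ[k] A}

lemma exists_lift_of_mem_range {X : Type} [AddCommGroup X] [Module k X] {j : D →ₐ[k] A}
    (hj : Function.Injective j) (F : X →ₗ[k] A) (hF : ∀ x, F x ∈ Set.range j) :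
    ∃ G : X →ₗ[k] D, j.toLinearMap ∘ₗ G = F := by
  let e := LinearEquiv.ofInjective j.toLinearMap hj
  refine ⟨e.symm.toLinearMap ∘ₗ F.codRestrict (LinearMap.range j.toLinearMap) hF, ?_⟩
  ext x
  exact congrArg Subtype.val (e.apply_symm_apply ⟨F x, hF x⟩)

lemma conv_comp_comp {C X Y : Type} [AddCommGroup C] [Module k C] [AddCommGroup X] [Module k X]
    [AddCommGroup Y] [Module k Y] (δC : C →ₗ[k] C ⊗[k] C) (F' : X →ₗ[k] A) (F : C →ₗ[k] X)
    (G' : Y →ₗ[k] A) (G : C →ₗ[k] Y) (c : C) :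
    conv k δC (F' ∘ₗ F) (G' ∘ₗ G) c =
      (LinearMap.mul' k A ∘ₗ TensorProduct.map F' G') (TensorProduct.map F G (δC c)) := by
  simp [conv, convG, TensorProduct.map_comp]

lemma conv_mulRight_comp (F G : H →ₗ[k] A) (c : A) :
    conv k W.δ F (LinearMap.mulRight k c ∘ₗ G) = LinearMap.mulRight k c ∘ₗ conv k W.δ F G := by
  ext x
  simp only [conv, convG, LinearMap.comp_apply]
  induction W.δ x with
  | zero => simp
  | add a b ha hb => simp only [map_add, ha, hb]
  | tmul r s => simp [mul_assoc]

lemma conv_eq_dot (hf : IsIntegral W ρ f) (G : H →ₗ[k] A) (x : H) :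
    conv k W.δ f G x = dot ρ LinearMap.id G (f x) := by
  simp only [conv, convG, dot, LinearMap.comp_apply, hf x]
  induction W.δ x with
  | zero => simp
  | add a b ha hb => simp only [map_add, ha, hb]
  | tmul r s => simp

lemma dGen_one (hρ : IsComodAlg W ρ) : dGen W (ρ 1) 1 = 1 := by
  conv_rhs => rw [← hρ.counit 1]
  simp only [dGen, LinearMap.comp_apply]
  induction ρ 1 with
  | zero => simp
  | add a b ha hb => simp only [map_add, LinearMap.add_apply, ha, hb]
  | tmul r s => simp

lemma fisEq_iff {φ ϕ : H ⊗[k] D →ₗ[k] D} {h hinv : H →ₗ[k] D} :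
    FisEq W φ ϕ h hinv ↔ ∀ d, φ ∘ₗ (TensorProduct.mk k H D).flip d =
      conv k W.δ (conv k W.δ h (ϕ ∘ₗ (TensorProduct.mk k H D).flip d)) hinv := by
  have key : ∀ (d : D) (t : H ⊗[k] H),
      (LinearMap.mul' k D ∘ₗ LinearMap.rTensor D (LinearMap.mul' k D))
        ((TensorProduct.map (TensorProduct.map h (ϕ ∘ₗ (TensorProduct.mk k H D).flip d)) hinv)
          ((LinearMap.rTensor H W.δ) t)) =
      LinearMap.mul' k D (TensorProduct.map
        (conv k W.δ h (ϕ ∘ₗ (TensorProduct.mk k H D).flip d)) hinv t) := by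
    intro d t
    induction t with
    | zero => simp
    | add a b ha hb => simp only [map_add, ha, hb]
    | tmul r s => simp [conv, convG]
  constructor
  · intro hF d
    ext x
    exact (hF x d).trans (key d _)
  · intro hF x d
    exact (LinearMap.congr_fun (hF d) x).trans (key d _).symm

/-- Any two total cleaving morphisms of a cleft extension induce equivalent crossed systems. -/
lemma crossedEquiv_of_cleaving (hW : IsWeakHopf W) (hρ : IsComodAlg W ρ)
    {j : D →ₐ[k] A} (hj : IsCoinvPres ρ j)
    (hf : IsCleaving W ρ f finv) (hf1 : f 1 = 1) (hg : IsCleaving W ρ g ginv) (hg1 : g 1 = 1)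
    {φf φg : H ⊗[k] D →ₗ[k] D} {σf σg : H ⊗[k] H →ₗ[k] D}
    (hφf : j.toLinearMap ∘ₗ φf = phiAmb W (LinearMap.mul' k A) f finv j.toLinearMap)
    (hσf : j.toLinearMap ∘ₗ σf = sigmaAmb W (LinearMap.mul' k A) f finv)
    (hφg : j.toLinearMap ∘ₗ φg = phiAmb W (LinearMap.mul' k A) g ginv j.toLinearMap)
    (hσg : j.toLinearMap ∘ₗ σg = sigmaAmb W (LinearMap.mul' k A) g ginv) :
    CrossedEquiv W φf φg σf σg := by
  have hjc : ∀ d, IsCoinv ρ (j d) := fun d => (hj.2 _).2 ⟨d, rfl⟩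
  have hca := fun F G G' : H →ₗ[k] A => conv_assoc hW.coassoc F G G'
  have inj : ∀ {X : Type} [AddCommGroup X] [Module k X] {F G : X →ₗ[k] D},
      j.toLinearMap ∘ₗ F = j.toLinearMap ∘ₗ G → F = G :=
    fun h => (LinearMap.cancel_left hj.1).1 h
  obtain ⟨h, hh⟩ := exists_lift_of_mem_range hj.1 (conv k W.δ f ginv) fun x => (hj.2 _).1 (by
    rw [conv_eq_dot hf.1]
    exact isCoinv_dot hW hρ hg _)
  obtain ⟨hinv, hhinv⟩ := exists_lift_of_mem_range hj.1 (conv k W.δ g finv) fun x =>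
    (hj.2 _).1 (by
      rw [conv_eq_dot hg.1]
      exact isCoinv_dot hW hρ hf _)
  have fe : conv k W.δ f (conv k W.δ ginv g) = f := by rw [hg.2.1.1, conv_eGen hρ hf.1]
  have ge : conv k W.δ g (conv k W.δ finv f) = g := by rw [hf.2.1.1, conv_eGen hρ hg.1]
  have ff : conv k W.δ f (conv k W.δ finv f) = f := by rw [hf.2.1.1, conv_eGen hρ hf.1]
  have gg : conv k W.δ g (conv k W.δ ginv g) = g := by rw [hg.2.1.1, conv_eGen hρ hg.1]
  have ef : conv k W.δ ginv (conv k W.δ g finv) = finv := by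
    rw [← hca, hg.2.1.1, ← hf.2.1.1, hf.2.1.2.2]
  have hfg : conv k W.δ f finv = conv k W.δ g ginv := by rw [hf.2.1.2.1, hg.2.1.2.1]
  have hu : u1 φf = u1 φg := inj (by
    rw [comp_u1_eq_conv hφf, comp_u1_eq_conv hφg, hfg])
  have hr : conv k W.δ h hinv = u1 φf := inj (by
    rw [comp_conv, comp_u1_eq_conv hφf, hh, hhinv, hca, ef])
  have hl : conv k W.δ hinv h = u1 φf := inj (by
    rw [comp_conv, comp_u1_eq_conv hφf, hh, hhinv, hca, ← hca finv, ← hca, ge, hfg])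
  have hreg : IsRegPair W φf h hinv := by
    refine ⟨hr, hl, inj ?_, inj ?_⟩
    · rw [hr, comp_conv, comp_u1_eq_conv hφf, hh, ← hca, hca f, ff]
    · rw [hl, comp_conv, comp_u1_eq_conv hφf, hhinv, hfg, ← hca, hca g, gg]
  refine ⟨hu, h, hinv, hreg, ?_, ?_, ?_, ?_⟩
  · simpa only [IsRegPair, hu] using hreg
  · apply hj.1
    have := LinearMap.congr_fun hh 1
    rw [conv_eq_dot hf.1, hf1, ← hg1, ← conv_eq_dot hg.1, hg.2.1.2.1, dGen_one hρ] at this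
    simpa using this
  · rw [fisEq_iff]
    intro d
    apply inj
    rw [comp_action_eq_conv hφf, comp_conv, comp_conv, comp_action_eq_conv hφg, hh, hhinv, hca,
      hca, hca, ef, ← hca, ← hca, hca f, conv_mulRight_comp, conv_mulRight_comp, fe]
  · apply inj
    rw [comp_conv, comp_conv, ← LinearMap.comp_assoc (LinearMap.mul' k H) hinv, hhinv, hσg, hσf]
    change _ = conv k (δ2 W) _ (conv k (δ2 W) (conv k (δ2 W) _ _) _)
    rw [conv_assoc hW.coassoc_δ2, conv_comp_mul hW, ef, ← conv_assoc hW.coassoc_δ2,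
      conv_twist hW h (conv_action hW hρ hg.1 hg.2.1 hjc hφg), hh, hca, fe]
    rfl

/-- The assignment `j d * f x ↦ jB d * g x` defines a colinear algebra morphism when `g` obeys the
commutation and product rules of the crossed system induced by the cleaving morphism `f`. -/
lemma exists_algHom_of_rules (hW : IsWeakHopf W) (hρ : IsComodAlg W ρ)
    {j : D →ₐ[k] A} (hj : IsCoinvPres ρ j) (hf : IsCleaving W ρ f finv)
    {φ : H ⊗[k] D →ₗ[k] D} {σ : H ⊗[k] H →ₗ[k] D}
    (hφ : j.toLinearMap ∘ₗ φ = phiAmb W (LinearMap.mul' k A) f finv j.toLinearMap)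
    (hσ : j.toLinearMap ∘ₗ σ = sigmaAmb W (LinearMap.mul' k A) f finv)
    {ρB : B →ₗ[k] B ⊗[k] H} (hρB : IsComodAlg W ρB) {jB : D →ₐ[k] B}
    (hjB : ∀ d, IsCoinv ρB (jB d)) {g : H →ₗ[k] B} (hg : IsIntegral W ρB g)
    (hgφ : ∀ d, conv k W.δ (jB.toLinearMap ∘ₗ φ ∘ₗ (TensorProduct.mk k H D).flip d) g =
      LinearMap.mulRight k (jB d) ∘ₗ g)
    (hgσ : conv k (δ2 W) (jB.toLinearMap ∘ₗ σ) (g ∘ₗ LinearMap.mul' k H) =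
      LinearMap.mul' k B ∘ₗ TensorProduct.map g g)
    (hgu : conv k W.δ (jB.toLinearMap ∘ₗ u1 φ) g = g)
    {v : H →ₗ[k] D} (hv : conv k W.δ (jB.toLinearMap ∘ₗ v) g 1 = 1) :
    ∃ T : A →ₐ[k] B,
      (∀ a : A, ρB (T a) = (LinearMap.rTensor H T.toLinearMap) (ρ a)) ∧
      (∀ d : D, T (j d) = jB d) := by
  have hjc : ∀ d, IsCoinv ρ (j d) := fun d => (hj.2 _).2 ⟨d, rfl⟩
  obtain ⟨q, hq⟩ := exists_lift_of_mem_range hj.1 (dot ρ LinearMap.id finv) fun x =>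
    (hj.2 _).1 (isCoinv_dot hW hρ hf _)
  let Φ : D ⊗[k] H →ₗ[k] A := LinearMap.mul' k A ∘ₗ TensorProduct.map j.toLinearMap f
  let Ψ : D ⊗[k] H →ₗ[k] B := LinearMap.mul' k B ∘ₗ TensorProduct.map jB.toLinearMap g
  let T : A →ₗ[k] B := Ψ ∘ₗ LinearMap.rTensor H q ∘ₗ ρ
  have hΦ : Function.Surjective Φ := by
    intro a
    refine ⟨LinearMap.rTensor H q (ρ a), ?_⟩
    have h := LinearMap.congr_fun (dot_coaction_eq_self hρ hf.2.1) a
    rw [← hq] at h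
    refine Eq.trans ?_ h
    change LinearMap.mul' k A ((TensorProduct.map j.toLinearMap f ∘ₗ LinearMap.rTensor H q) _) = _
    rw [LinearMap.map_comp_rTensor]
    rfl
  have hρjf : ∀ d x, ρ (j d * f x) = LinearMap.rTensor H (LinearMap.mulLeft k (j d) ∘ₗ f)
      (W.δ x) := by
    intro d x
    rw [coaction_coinv_mul hW hρ (hjc d), hf.1]
    induction W.δ x with
    | zero => simp
    | add a b ha hb => simp only [map_add, mul_add, ha, hb]
    | tmul r s => simp
  have hqf : ∀ d x, q (j d * f x) = d * u1 φ x := by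
    intro d x
    apply hj.1
    have h := LinearMap.congr_fun hq (j d * f x)
    have hu := LinearMap.congr_fun (comp_u1_eq_conv hφ) x
    simp only [LinearMap.comp_apply, AlgHom.toLinearMap_apply] at h hu
    rw [h, map_mul j, hu]
    simp only [dot, conv, convG, LinearMap.comp_apply, hρjf]
    induction W.δ x with
    | zero => simp
    | add a b ha hb => simp only [map_add, mul_add, ha, hb]
    | tmul r s => simp [mul_assoc]
  have hT : ∀ d x, T (j d * f x) = jB d * g x := by
    intro d x
    conv_rhs => rw [← hgu]
    simp only [T, Ψ, conv, convG, LinearMap.comp_apply, hρjf]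
    induction W.δ x with
    | zero => simp
    | add a b ha hb => simp only [map_add, mul_add, ha, hb]
    | tmul r s => simp [hqf, mul_assoc]
  have hTΦ : ∀ s, T (Φ s) = Ψ s := by
    intro s
    induction s with
    | zero => simp
    | add a b ha hb => simp only [map_add, ha, hb]
    | tmul d x => exact hT d x
  have hTj : ∀ d a, T (j d * a) = jB d * T a := by
    intro d a
    obtain ⟨s, rfl⟩ := hΦ a
    induction s with
    | zero => simp
    | add a b ha hb => simp only [map_add, mul_add, ha, hb]
    | tmul e x =>
      change T (j d * (j e * f x)) = jB d * T (j e * f x)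
      rw [hT, ← mul_assoc, ← map_mul, hT, map_mul, mul_assoc]
  have hTff : ∀ x y, T (f x * f y) = g x * g y := by
    intro x y
    have h1 : f x * f y = Φ (σHA W σ (x ⊗ₜ[k] y)) :=
      (LinearMap.congr_fun (conv_cocycle hW hρ hf.1 hf.2.1 hσ) (x ⊗ₜ[k] y)).symm.trans
        (conv_comp_comp _ _ _ _ _ _)
    have h2 : g x * g y = Ψ (σHA W σ (x ⊗ₜ[k] y)) :=
      (LinearMap.congr_fun hgσ (x ⊗ₜ[k] y)).symm.trans (conv_comp_comp _ _ _ _ _ _)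
    rw [h1, h2, hTΦ]
  have hTΦf : ∀ s y, T (Φ s * f y) = Ψ s * g y := by
    intro s y
    induction s with
    | zero => simp
    | add a b ha hb => simp only [map_add, add_mul, ha, hb]
    | tmul d x =>
      change T (j d * f x * f y) = jB d * g x * g y
      rw [mul_assoc, hTj, hTff, mul_assoc]
  have hTfjf : ∀ x d y, T (f x * j d * f y) = g x * jB d * g y := by
    intro x d y
    let s := LinearMap.rTensor H (φ ∘ₗ (TensorProduct.mk k H D).flip d) (W.δ x)
    have h1 : f x * j d = Φ s :=
      (LinearMap.congr_fun (conv_action hW hρ hf.1 hf.2.1 hjc hφ d) x).symm.trans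
        (conv_comp_comp _ _ _ f LinearMap.id _)
    have h2 : g x * jB d = Ψ s := (LinearMap.congr_fun (hgφ d) x).symm.trans
      (conv_comp_comp _ _ _ g LinearMap.id _)
    rw [h1, h2, hTΦf]
  have hTmul : ∀ a b, T (a * b) = T a * T b := by
    intro a b
    obtain ⟨s, rfl⟩ := hΦ a
    obtain ⟨t, rfl⟩ := hΦ b
    induction s with
    | zero => simp
    | add a b ha hb => simp only [map_add, add_mul, ha, hb]
    | tmul d x =>
      induction t with
      | zero => simp
      | add a b ha hb => simp only [map_add, mul_add, ha, hb]
      | tmul e y =>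
        change T (j d * f x * (j e * f y)) = T (j d * f x) * T (j e * f y)
        rw [hT, hT, mul_assoc, hTj, ← mul_assoc, hTfjf]
        simp only [mul_assoc]
  have hTone : T 1 = 1 := by
    have h1 : T (Φ (LinearMap.rTensor H v (W.δ 1))) = 1 := by
      rw [hTΦ, ← hv]
      exact (conv_comp_comp _ _ _ g LinearMap.id _).symm
    rw [← mul_one (T 1), ← h1, ← hTmul, one_mul]
  refine ⟨AlgHom.ofLinearMap T hTone hTmul, ?_, ?_⟩
  · intro a
    change ρB (T a) = LinearMap.rTensor H T (ρ a)
    obtain ⟨s, rfl⟩ := hΦ a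
    induction s with
    | zero => simp
    | add a b ha hb => simp only [map_add, ha, hb]
    | tmul d x =>
      change ρB (T (j d * f x)) = LinearMap.rTensor H T (ρ (j d * f x))
      rw [hT, hρjf, coaction_coinv_mul hW hρB (hjB d), hg]
      induction W.δ x with
      | zero => simp
      | add a b ha hb => simp only [map_add, mul_add, ha, hb]
      | tmul r s => simp [hT]
  · intro d
    change T (j d) = jB d
    rw [← mul_one (j d), hTj, hTone, mul_one]

/-- Cleaving morphisms are preserved by morphisms of comodule algebras. -/
lemma IsCleaving.map (hf : IsCleaving W ρ f finv)
    {ρB : B →ₗ[k] B ⊗[k] H} (T : A →ₐ[k] B)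
    (hT : ∀ a : A, ρB (T a) = (LinearMap.rTensor H T.toLinearMap) (ρ a))
    (hc : ∀ h, IsCoinv ρB (dGen W (ρB 1) h)) :
    IsCleaving W ρB (T.toLinearMap ∘ₗ f) (T.toLinearMap ∘ₗ finv) := by
  have h1 : ρB 1 = LinearMap.rTensor H T.toLinearMap (ρ 1) := by rw [← hT, map_one T]
  have hd : T.toLinearMap ∘ₗ dGen W (ρ 1) = dGen W (ρB 1) := by
    ext x
    rw [h1]
    simp only [dGen, LinearMap.comp_apply]
    induction ρ 1 with
    | zero => simp
    | add a b ha hb => simp only [map_add, LinearMap.add_apply, ha, hb]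
    | tmul r s => simp
  have he : T.toLinearMap ∘ₗ eGen W (ρ 1) = eGen W (ρB 1) := by
    ext x
    rw [h1]
    simp only [eGen, LinearMap.comp_apply]
    induction ρ 1 with
    | zero => simp
    | add a b ha hb => simp only [map_add, LinearMap.add_apply, ha, hb]
    | tmul r s => simp
  have hconv : conv k W.δ (T.toLinearMap ∘ₗ f) (T.toLinearMap ∘ₗ finv) = dGen W (ρB 1) := by
    rw [← comp_conv, hf.2.1.2.1, hd]
  refine ⟨?_, ⟨?_, hconv, ?_⟩, ?_⟩
  · intro x
    rw [LinearMap.rTensor_comp_apply, ← hf.1 x]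
    exact hT _
  · rw [← comp_conv, hf.2.1.1, he]
  · rw [← comp_conv, ← comp_conv, hf.2.1.2.2]
  · rw [hconv]
    exact hc

lemma phiAmb_map {j : D →ₐ[k] A} (T : A →ₐ[k] B) :
    T.toLinearMap ∘ₗ phiAmb W (LinearMap.mul' k A) f finv j.toLinearMap =
      phiAmb W (LinearMap.mul' k B) (T.toLinearMap ∘ₗ f) (T.toLinearMap ∘ₗ finv)
        (T.toLinearMap ∘ₗ j.toLinearMap) := by
  ext x d
  simp only [phiAmb, mulSwizG, AlgebraTensorModule.curry_apply, LinearMap.restrictScalars_self,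
    curry_apply, LinearMap.comp_apply, TensorProduct.map_tmul]
  induction W.δ x with
  | zero => simp
  | add a b ha hb => simp only [map_add, add_tmul, ha, hb]
  | tmul r s => simp

lemma sigmaAmb_map (T : A →ₐ[k] B) :
    T.toLinearMap ∘ₗ sigmaAmb W (LinearMap.mul' k A) f finv =
      sigmaAmb W (LinearMap.mul' k B) (T.toLinearMap ∘ₗ f) (T.toLinearMap ∘ₗ finv) := by
  change T.toLinearMap ∘ₗ conv k (δ2 W) _ _ = conv k (δ2 W) _ _
  rw [comp_conv, LinearMap.comp_assoc]
  congr 1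
  ext
  simp

/-- If `h` conjugates the crossed system `(ϕ, τ)` of `g` into `(φ, σ)`, then `h ∧ g` obeys the
rules of `(φ, σ)`, and so gives rise to an equivalence of extensions. -/
lemma exists_algHom_of_crossedEquiv (hW : IsWeakHopf W) (hρ : IsComodAlg W ρ)
    {j : D →ₐ[k] A} (hj : IsCoinvPres ρ j) (hf : IsCleaving W ρ f finv)
    {φ ϕ : H ⊗[k] D →ₗ[k] D} {σ τ : H ⊗[k] H →ₗ[k] D}
    (hφ : j.toLinearMap ∘ₗ φ = phiAmb W (LinearMap.mul' k A) f finv j.toLinearMap)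
    (hσ : j.toLinearMap ∘ₗ σ = sigmaAmb W (LinearMap.mul' k A) f finv)
    {ρB : B →ₗ[k] B ⊗[k] H} (hρB : IsComodAlg W ρB) {jB : D →ₐ[k] B}
    (hjB : ∀ d, IsCoinv ρB (jB d)) {g ginv : H →ₗ[k] B} (hg : IsCleaving W ρB g ginv)
    (hg1 : g 1 = 1)
    (hϕ : jB.toLinearMap ∘ₗ ϕ = phiAmb W (LinearMap.mul' k B) g ginv jB.toLinearMap)
    (hτ : jB.toLinearMap ∘ₗ τ = sigmaAmb W (LinearMap.mul' k B) g ginv)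
    (heq : CrossedEquiv W φ ϕ σ τ) :
    ∃ T : A →ₐ[k] B,
      (∀ a : A, ρB (T a) = (LinearMap.rTensor H T.toLinearMap) (ρ a)) ∧
      (∀ d : D, T (j d) = jB d) := by
  obtain ⟨hu, h, hinv, hreg, hreg', -, hF, hS⟩ := heq
  rw [fisEq_iff] at hF
  have hca := fun F G G' : H →ₗ[k] B => conv_assoc hW.coassoc F G G'
  have hug : conv k W.δ (jB.toLinearMap ∘ₗ u1 ϕ) g = g := by
    rw [comp_u1_eq_conv hϕ, hca, hg.2.1.1, conv_eGen hρB hg.1]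
  have hinvhg : conv k W.δ (jB.toLinearMap ∘ₗ hinv) (conv k W.δ (jB.toLinearMap ∘ₗ h) g) = g := by
    rw [← hca, ← comp_conv, hreg'.2.1, hug]
  have hact := conv_action hW hρB hg.1 hg.2.1 hjB hϕ
  refine exists_algHom_of_rules hW hρ hj hf hφ hσ hρB hjB
    (g := conv k W.δ (jB.toLinearMap ∘ₗ h) g) ?_ ?_ ?_ ?_ (v := hinv) ?_
  · intro x
    refine Eq.trans ?_ (LinearMap.congr_fun
      (dot_includeLeft_coaction hg.1 hW.coassoc (jB.toLinearMap ∘ₗ h)) x)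
    simp only [conv, convG, dot, LinearMap.comp_apply]
    induction W.δ x with
    | zero => simp
    | add a b ha hb => simp only [map_add, ha, hb]
    | tmul r s => simp [coaction_coinv_mul hW hρB (hjB _)]
  · intro d
    rw [hF, comp_conv, comp_conv, hca, hinvhg, hca, hact, conv_mulRight_comp]
  · rw [hS, comp_conv, comp_conv, ← LinearMap.comp_assoc (LinearMap.mul' k H) hinv,
      conv_assoc hW.coassoc_δ2, conv_assoc hW.coassoc_δ2, conv_comp_mul hW, hinvhg,
      conv_cocycle hW hρB hg.1 hg.2.1 hτ, conv_twist hW h hact]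
  · rw [← hca, ← comp_conv, ← hreg.1, hreg.2.2.1]
  · rw [hinvhg, hg1]

end Equivalence

end Auxiliary

/-- Two `H`-cleft extensions `A_H ↪ A` and `A_H ↪ B` with
the same coinvariant algebra (presented by `jA : D → A` and `jB : D → B`),
each admitting a convolution invertible total integral, are equivalent if and
only if their associated crossed systems on `A_H = D` are equivalent. -/
theorem statement18 {k H A B D : Type} [CommRing k] [Ring H] [Algebra k H]
    [Ring A] [Algebra k A] [Ring B] [Algebra k B] [Ring D] [Algebra k D]
    (W : HopfData k H) (hW : IsWeakHopf W) (hcc : Cocomm W)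
    (ρA : A →ₗ[k] A ⊗[k] H) (hρA : IsComodAlg W ρA)
    (ρB : B →ₗ[k] B ⊗[k] H) (hρB : IsComodAlg W ρB)
    (jA : D →ₐ[k] A) (hjA : IsCoinvPres ρA jA)
    (jB : D →ₐ[k] B) (hjB : IsCoinvPres ρB jB)
    (f finv : H →ₗ[k] A) (hf : IsCleaving W ρA f finv) (hftot : f 1 = 1)
    (g ginv : H →ₗ[k] B) (hg : IsCleaving W ρB g ginv) (hgtot : g 1 = 1)
    -- the associated crossed systems on `D`:
    (φf : H ⊗[k] D →ₗ[k] D)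
    (hφf : jA.toLinearMap ∘ₗ φf = phiAmb W (LinearMap.mul' k A) f finv jA.toLinearMap)
    (σf : H ⊗[k] H →ₗ[k] D)
    (hσf : jA.toLinearMap ∘ₗ σf = sigmaAmb W (LinearMap.mul' k A) f finv)
    (φg : H ⊗[k] D →ₗ[k] D)
    (hφg : jB.toLinearMap ∘ₗ φg = phiAmb W (LinearMap.mul' k B) g ginv jB.toLinearMap)
    (σg : H ⊗[k] H →ₗ[k] D)
    (hσg : jB.toLinearMap ∘ₗ σg = sigmaAmb W (LinearMap.mul' k B) g ginv) :
    (∃ T : A →ₐ[k] B,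
        (∀ a : A, ρB (T a) = (LinearMap.rTensor H T.toLinearMap) (ρA a)) ∧
        (∀ d : D, T (jA d) = jB d)) ↔
    CrossedEquiv W φf φg σf σg := by
  constructor
  · rintro ⟨T, hT, hTj⟩
    have hj : T.toLinearMap ∘ₗ jA.toLinearMap = jB.toLinearMap := LinearMap.ext hTj
    have hfB := hf.map T hT (by simpa only [hg.2.1.2.1] using hg.2.2)
    refine crossedEquiv_of_cleaving hW hρB hjB hfB (by simp [hftot]) hg hgtot ?_ ?_ hφg hσg
    · rw [← hj, LinearMap.comp_assoc, hφf, phiAmb_map]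
    · rw [← hj, LinearMap.comp_assoc, hσf, sigmaAmb_map]
  · exact exists_algHom_of_crossedEquiv hW hρA hjA hf hφf hσf hρB
      (fun d => (hjB.2 _).2 ⟨d, rfl⟩) hg hgtot hφg hσg

end WHA

end
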